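/- arXiv:1301.7349 — 2 statements merged into one kernel-verified Lean document; each statement's English description precedes it below -/
import Mathlib

section
/- Let f : [0,∞) → ℝ be operator convex with f(0) ≤ 0, let h : [0,∞) → ℝ be operator concave with h(t) > 0 for all t ≥ 0, let p = (p_1,…,p_n) and q = (q_1,…,q_n) be probability distributions, and let Φ be a unital positive linear map on the bounded operators on H. Then for positive operators L_1,…,L_n and strictly positive operators R_1,…,R_n on H, ∑_{i=1}^n p_i · h(q_iΦ(R_i))^{1/2} f(h(q_iΦ(R_i))^{−1/2} Φ(L_i) h(q_iΦ(R_i))^{−1/2}) h(q_iΦ(R_i))^{1/2} ≤ Φ(∑_{i=1}^n p_i · h(q_iR_i)^{1/2} f(h(q_iR_i)^{−1/2} L_i h(q_iR_i)^{−1/2}) h(q_iR_i)^{1/2}) in the Loewner order. -/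
open scoped InnerProductSpace

noncomputable section

/-- A continuous function `f : [0, ∞) → ℝ` is *operator convex* if for every complex Hilbert
space `K`, all selfadjoint operators `A, B` on `K` with spectra in `[0, ∞)` and every
`λ ∈ [0, 1]` one has `f(λA + (1-λ)B) ≤ λ f(A) + (1-λ) f(B)` in the Loewner order, where
`f(A)` is given by the continuous functional calculus. -/
def OperatorConvexOn (f : ℝ → ℝ) : Prop :=
  ∀ (K : Type) [NormedAddCommGroup K] [InnerProductSpace ℂ K] [CompleteSpace K],
    ∀ A B : K →L[ℂ] K, IsSelfAdjoint A → IsSelfAdjoint B →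
      spectrum ℝ A ⊆ Set.Ici (0 : ℝ) → spectrum ℝ B ⊆ Set.Ici (0 : ℝ) →
      ∀ lam : ℝ, lam ∈ Set.Icc (0 : ℝ) 1 →
        cfc f (lam • A + (1 - lam) • B) ≤ lam • cfc f A + (1 - lam) • cfc f B

variable {H : Type} [NormedAddCommGroup H] [InnerProductSpace ℂ H] [CompleteSpace H]

/-- `R^{1/2}` via the continuous functional calculus. -/
def opSqrt (R : H →L[ℂ] H) : H →L[ℂ] H := cfc Real.sqrt R

/-- `R^{-1/2}` via the continuous functional calculus. -/
def opInvSqrt (R : H →L[ℂ] H) : H →L[ℂ] H := cfc (fun t : ℝ => (Real.sqrt t)⁻¹) R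

/-- The non-commutative perspective `g(L, R) = R^{1/2} f(R^{-1/2} L R^{-1/2}) R^{1/2}`. -/
def persp (f : ℝ → ℝ) (L R : H →L[ℂ] H) : H →L[ℂ] H :=
  opSqrt R * cfc f (opInvSqrt R * L * opInvSqrt R) * opSqrt R

/-- A continuous function `h : [0, ∞) → ℝ` is *operator concave* if `-h` is operator convex. -/
def OperatorConcaveOn (h : ℝ → ℝ) : Prop :=
  ∀ (K : Type) [NormedAddCommGroup K] [InnerProductSpace ℂ K] [CompleteSpace K],
    ∀ A B : K →L[ℂ] K, IsSelfAdjoint A → IsSelfAdjoint B →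
      spectrum ℝ A ⊆ Set.Ici (0 : ℝ) → spectrum ℝ B ⊆ Set.Ici (0 : ℝ) →
      ∀ lam : ℝ, lam ∈ Set.Icc (0 : ℝ) 1 →
        lam • cfc h A + (1 - lam) • cfc h B ≤ cfc h (lam • A + (1 - lam) • B)


/-- `(fΔh)(A, B) = h(B)^{1/2} f(h(B)^{-1/2} A h(B)^{-1/2}) h(B)^{1/2}`. -/
def fDelta (f h : ℝ → ℝ) {H : Type} [NormedAddCommGroup H] [InnerProductSpace ℂ H]
    [CompleteSpace H] (A B : H →L[ℂ] H) : H →L[ℂ] H :=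
  opSqrt (cfc h B) * cfc f (opInvSqrt (cfc h B) * A * opInvSqrt (cfc h B)) * opSqrt (cfc h B)

lemma aeval_intertwine {E F : Type} [NormedAddCommGroup E] [InnerProductSpace ℂ E]
    [NormedAddCommGroup F] [InnerProductSpace ℂ F] (X : E →L[ℂ] F) {M : E →L[ℂ] E} {N : F →L[ℂ] F}
    (h : X ∘L M = N ∘L X) (P : Polynomial ℝ) :
    X ∘L Polynomial.aeval M P = Polynomial.aeval N P ∘L X := by
  induction P using Polynomial.induction_on' with
  | add p q hp hq => simp only [map_add, ContinuousLinearMap.comp_add,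
      ContinuousLinearMap.add_comp, hp, hq]
  | monomial k a =>
    have hk : X ∘L (M ^ k) = (N ^ k) ∘L X := by
      induction k with
      | zero => ext; simp
      | succ k ih =>
        ext x
        have h1 := congrArg (fun T : E →L[ℂ] F ↦ T (M x)) ih
        have h2 := congrArg (fun T : E →L[ℂ] F ↦ T x) h
        simp only [ContinuousLinearMap.comp_apply] at h1 h2
        simp only [pow_succ, ContinuousLinearMap.comp_apply, mul_apply_eq_comp]
        rw [h1, h2]
    ext x
    have h1 := congrArg (fun T : E →L[ℂ] F ↦ T x) hk
    simp only [ContinuousLinearMap.comp_apply] at h1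
    simp only [Polynomial.aeval_monomial, Algebra.algebraMap_eq_smul_one, smul_mul_assoc, one_mul,
      ContinuousLinearMap.comp_apply, smul_apply,
      ContinuousLinearMap.map_smul_of_tower, h1]

section

variable {E F : Type} [NormedAddCommGroup E] [InnerProductSpace ℂ E] [CompleteSpace E]
  [NormedAddCommGroup F] [InnerProductSpace ℂ F] [CompleteSpace F]

lemma continuousOn_spectrum_of_nonneg {f : ℝ → ℝ} (hf : ContinuousOn f (Set.Ici 0))
    {A : E →L[ℂ] E} (hA : 0 ≤ A) : ContinuousOn f (spectrum ℝ A) :=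
  hf.mono fun _ hx ↦ spectrum_nonneg_of_nonneg hA hx

lemma cfc_intertwine {f : ℝ → ℝ} (hf : ContinuousOn f (Set.Ici 0)) (X : E →L[ℂ] F)
    {M : E →L[ℂ] E} {N : F →L[ℂ] F} (hM : 0 ≤ M) (hN : 0 ≤ N)
    (h : X ∘L M = N ∘L X) : X ∘L cfc f M = cfc f N ∘L X := by
  have hMs : IsSelfAdjoint M := .of_nonneg hM
  have hNs : IsSelfAdjoint N := .of_nonneg hN
  have key : ∀ ε : ℝ, 0 < ε → ‖X ∘L cfc f M - cfc f N ∘L X‖ ≤ ε * (2 * ‖X‖) := by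
    intro ε hε
    obtain ⟨P, hP⟩ := exists_polynomial_near_of_continuousOn 0 (max ‖M‖ ‖N‖) f
      (hf.mono fun x hx ↦ hx.1) ε hε
    have approx : ∀ {G : Type} [NormedAddCommGroup G] [InnerProductSpace ℂ G] [CompleteSpace G]
        (T : G →L[ℂ] G), 0 ≤ T → ‖T‖ ≤ max ‖M‖ ‖N‖ →
        ‖cfc f T - Polynomial.aeval T P‖ ≤ ε := by
      intro G _ _ _ T hT hTn
      have hTs : IsSelfAdjoint T := .of_nonneg hT
      rw [← cfc_polynomial P T, ← cfc_sub f _ T (continuousOn_spectrum_of_nonneg hf hT)]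
      refine norm_cfc_le hε.le fun x hx ↦ ?_
      rw [Real.norm_eq_abs, abs_sub_comm]
      refine (hP x ⟨spectrum_nonneg_of_nonneg hT hx, ?_⟩).le
      rcases subsingleton_or_nontrivial G with hG | hG
      · have : Subsingleton (G →L[ℂ] G) := inferInstance
        simp [spectrum.of_subsingleton] at hx
      · exact (le_abs_self x).trans ((spectrum.norm_le_norm_of_mem hx).trans hTn)
    have h1 := approx M hM (le_max_left _ _)
    have h2 := approx N hN (le_max_right _ _)
    have h3 : X ∘L cfc f M - cfc f N ∘L X =
        X ∘L (cfc f M - Polynomial.aeval M P) - (cfc f N - Polynomial.aeval N P) ∘L X := by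
      rw [ContinuousLinearMap.comp_sub, ContinuousLinearMap.sub_comp, aeval_intertwine X h P]
      abel
    rw [h3]
    calc _ ≤ ‖X ∘L (cfc f M - Polynomial.aeval M P)‖
          + ‖(cfc f N - Polynomial.aeval N P) ∘L X‖ := norm_sub_le _ _
      _ ≤ ‖X‖ * ε + ε * ‖X‖ := by
          gcongr
          · exact (ContinuousLinearMap.opNorm_comp_le _ _).trans (by gcongr)
          · exact (ContinuousLinearMap.opNorm_comp_le _ _).trans (by gcongr)
      _ = _ := by ring
  rw [← sub_eq_zero, ← norm_le_zero_iff]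
  refine le_of_forall_pos_le_add fun δ hδ ↦ (key (δ / (2 * ‖X‖ + 1)) (by positivity)).trans ?_
  rw [zero_add, div_mul_eq_mul_div, div_le_iff₀ (by positivity)]
  nlinarith [norm_nonneg X]

lemma adjoint_conj_mono (V : E →L[ℂ] F) {S T : F →L[ℂ] F} (h : S ≤ T) :
    V.adjoint ∘L S ∘L V ≤ V.adjoint ∘L T ∘L V := by
  rw [ContinuousLinearMap.le_def] at h ⊢
  have := h.adjoint_conj V
  convert this using 1
  ext; simp

lemma adjoint_conj_nonneg (V : E →L[ℂ] F) {S : F →L[ℂ] F} (h : 0 ≤ S) :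
    0 ≤ V.adjoint ∘L S ∘L V := by
  simpa using adjoint_conj_mono V h

/-- Jensen's operator inequality for the compression by an isometry. -/
lemma OperatorConvexOn.cfc_compression_le {f : ℝ → ℝ} (hfc : ContinuousOn f (Set.Ici 0))
    (hf : OperatorConvexOn f) (V : E →L[ℂ] F) (hV : V.adjoint ∘L V = 1)
    {M : F →L[ℂ] F} (hM : 0 ≤ M) :
    cfc f (V.adjoint ∘L M ∘L V) ≤ V.adjoint ∘L cfc f M ∘L V := by
  have hV' : ∀ x, V.adjoint (V x) = x := fun x ↦ congrArg (fun T : E →L[ℂ] E ↦ T x) hV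
  set U : F →L[ℂ] F := (2 : ℝ) • (V ∘L V.adjoint) - 1 with hU
  have hUs : IsSelfAdjoint U := by
    have h : IsSelfAdjoint (V ∘L V.adjoint) := by
      rw [ContinuousLinearMap.isSelfAdjoint_iff', ContinuousLinearMap.adjoint_comp,
        ContinuousLinearMap.adjoint_adjoint]
    exact (IsSelfAdjoint.smul (.all _) h).sub (.one _)
  have hUV : ∀ x, U (V x) = V x := fun x ↦ by simp [hU, hV', two_smul]
  have hVU : ∀ x, V.adjoint (U x) = V.adjoint x := fun x ↦ by simp [hU, hV', two_smul]
  have hUU : ∀ x, U (U x) = x := fun x ↦ by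
    have hUa : ∀ z, U z = (2 : ℝ) • V (V.adjoint z) - z := fun z ↦ by simp [hU]
    rw [hUa (U x), hVU, hUa]
    abel
  have hUMU : 0 ≤ U * M * U := hUs.conjugate_nonneg hM
  set W : F →L[ℂ] F := (1 / 2 : ℝ) • M + (1 - 1 / 2 : ℝ) • (U * M * U) with hW
  have hW0 : 0 ≤ W := add_nonneg (smul_nonneg (by norm_num) hM) (smul_nonneg (by norm_num) hUMU)
  have hconv : cfc f W ≤ (1 / 2 : ℝ) • cfc f M + (1 - 1 / 2 : ℝ) • cfc f (U * M * U) :=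
    hf F M (U * M * U) (.of_nonneg hM) (.of_nonneg hUMU)
      (fun _ hx ↦ spectrum_nonneg_of_nonneg hM hx)
      (fun _ hx ↦ spectrum_nonneg_of_nonneg hUMU hx) _ ⟨by norm_num, by norm_num⟩
  have h1 : V ∘L cfc f (V.adjoint ∘L M ∘L V) = cfc f W ∘L V := by
    refine cfc_intertwine hfc V (adjoint_conj_nonneg V hM) hW0 ?_
    ext x
    simp only [hW, ContinuousLinearMap.comp_apply, add_apply,
      smul_apply, mul_apply_eq_comp, hUV]
    simp only [hU, sub_apply, smul_apply,
      ContinuousLinearMap.comp_apply, one_apply_eq_self]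
    module
  have h2 : U ∘L cfc f M = cfc f (U * M * U) ∘L U := by
    refine cfc_intertwine hfc U hM hUMU ?_
    ext x
    simp [hUU]
  have h1' := fun x ↦ congrArg (fun T : E →L[ℂ] F ↦ V.adjoint (T x)) h1
  have h2' := fun x ↦ congrArg (fun T : F →L[ℂ] F ↦ V.adjoint (T (V x))) h2
  simp only [ContinuousLinearMap.comp_apply, hV', hVU, hUV] at h1' h2'
  convert adjoint_conj_mono V hconv using 1
  · ext x
    simp [h1']
  · ext x
    simp only [ContinuousLinearMap.comp_apply, add_apply,
      smul_apply, map_add, ContinuousLinearMap.map_smul_of_tower, ← h2']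
    module

/-- Jensen's operator inequality for scalars weighted by a positive resolution of the identity. -/
lemma OperatorConvexOn.cfc_sum_smul_le {f : ℝ → ℝ} (hfc : ContinuousOn f (Set.Ici 0))
    (hf : OperatorConvexOn f) {ι : Type} [Fintype ι] (A : ι → E →L[ℂ] E) (hA : ∀ i, 0 ≤ A i)
    (hA1 : ∑ i, A i = 1) (t : ι → ℝ) (ht : ∀ i, 0 ≤ t i) :
    cfc f (∑ i, t i • A i) ≤ ∑ i, f (t i) • A i := by
  classical
  let S : ι → E →L[ℂ] E := fun i ↦ CFC.sqrt (A i)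
  have hSs : ∀ i, (S i).adjoint = S i := fun i ↦
    (IsSelfAdjoint.of_nonneg (CFC.sqrt_nonneg (A i))).star_eq
  have hSS : ∀ i x, S i (S i x) = A i x := fun i x ↦
    congrArg (fun T : E →L[ℂ] E ↦ T x) (CFC.sqrt_mul_sqrt_self (A i) (hA i))
  let K := PiLp 2 (fun _ : ι ↦ E)
  let V : E →L[ℂ] K := (PiLp.continuousLinearEquiv 2 ℂ (fun _ : ι ↦ E)).symm.toContinuousLinearMap ∘L
    ContinuousLinearMap.pi S
  let D : (ι → ℝ) → K →L[ℂ] K := fun s ↦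
    (PiLp.continuousLinearEquiv 2 ℂ (fun _ : ι ↦ E)).symm.toContinuousLinearMap ∘L
      ContinuousLinearMap.pi fun i ↦ s i • PiLp.proj 2 (fun _ : ι ↦ E) i
  have hVa : ∀ x i, V x i = S i x := fun _ _ ↦ rfl
  have hDa : ∀ s z i, D s z i = s i • z i := fun _ _ _ ↦ rfl
  have hVD : ∀ s, V.adjoint ∘L D s ∘L V = ∑ i, s i • A i := by
    intro s
    ext x
    refine ext_inner_left ℂ fun y ↦ ?_
    rw [ContinuousLinearMap.comp_apply, ContinuousLinearMap.adjoint_inner_right, PiLp.inner_apply]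
    simp only [ContinuousLinearMap.comp_apply, hVa, hDa, sum_apply,
      smul_apply, inner_sum]
    refine Finset.sum_congr rfl fun i _ ↦ ?_
    rw [← hSS, ← (S i).map_smul_of_tower (s i) (S i x),
      ← ContinuousLinearMap.adjoint_inner_left (S i) (s i • S i x) y, hSs]
  have hD1 : D 1 = 1 := by
    ext z i
    simp [hDa]
  have hV : V.adjoint ∘L V = 1 := by
    have h := hVD 1
    simp only [Pi.one_apply, one_smul, hA1, hD1] at h
    exact h
  have hD0 : 0 ≤ D t := by
    have : D t = (D fun i ↦ √(t i)).adjoint ∘L 1 ∘L (D fun i ↦ √(t i)) := by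
      ext1 z
      refine ext_inner_left ℂ fun y ↦ ?_
      change _ = inner ℂ y ((D fun i ↦ √(t i)).adjoint ((1 ∘L D fun i ↦ √(t i)) z))
      rw [ContinuousLinearMap.adjoint_inner_right, PiLp.inner_apply, PiLp.inner_apply]
      refine Finset.sum_congr rfl fun i _ ↦ ?_
      simp only [ContinuousLinearMap.comp_apply, hDa, one_apply_eq_self]
      rw [← Complex.coe_smul, ← Complex.coe_smul, ← Complex.coe_smul, inner_smul_left,
        inner_smul_right, inner_smul_right, ← mul_assoc, Complex.conj_ofReal,
        ← Complex.ofReal_mul, Real.mul_self_sqrt (ht i)]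
    rw [this]
    exact adjoint_conj_nonneg _ zero_le_one
  have hfD : cfc f (D t) = D fun i ↦ f (t i) := by
    ext z i
    have h0 : (0 : E →L[ℂ] E) ≤ algebraMap ℝ _ (t i) := by
      rw [Algebra.algebraMap_eq_smul_one]
      exact smul_nonneg (ht i) zero_le_one
    have h := cfc_intertwine hfc (PiLp.proj 2 (fun _ : ι ↦ E) i : K →L[ℂ] E) hD0 h0 (by
      ext z
      simp [hDa, Algebra.algebraMap_eq_smul_one])
    rw [cfc_algebraMap] at h
    have hz := congrArg (fun T : K →L[ℂ] E ↦ T z) h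
    rw [Algebra.algebraMap_eq_smul_one] at hz
    exact hz
  have := hf.cfc_compression_le hfc V hV hD0
  rwa [hfD, hVD, hVD] at this

end

lemma exists_partition_approx {g : ℝ → ℝ} {c : ℝ} (hc : 0 < c)
    (hg : ContinuousOn g (Set.Icc 0 c)) {ε : ℝ} (hε : 0 < ε) :
    ∃ (m : ℕ) (φ : Fin m → ℝ → ℝ) (t : Fin m → ℝ), (∀ i, Continuous (φ i)) ∧ (∀ i, 0 ≤ t i) ∧
      ∀ x ∈ Set.Icc 0 c, (∀ i, 0 ≤ φ i x) ∧ ∑ i, φ i x = 1 ∧ ∑ i, t i * φ i x = x ∧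
        ∑ i, g (t i) * φ i x ≤ g x + ε := by
  have hmem : ∀ x : unitInterval, c * (x : ℝ) ∈ Set.Icc 0 c := fun x ↦
    ⟨mul_nonneg hc.le x.2.1, mul_le_of_le_one_right hc.le x.2.2⟩
  let G : C(unitInterval, ℝ) := ⟨fun x ↦ g (c * x),
    hg.comp_continuous (by fun_prop) hmem⟩
  have hlim := Metric.tendsto_atTop.mp (bernsteinApproximation_uniform G) ε hε
  obtain ⟨N, hN⟩ := hlim
  set n := N + 1 with hn
  refine ⟨n + 1, fun k x ↦ (bernsteinPolynomial ℝ n k).eval (x / c),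
    fun k ↦ c * (bernstein.z k : ℝ), fun k ↦ by fun_prop, fun k ↦ (hmem _).1, fun x hx ↦ ?_⟩
  let y : unitInterval := ⟨x / c, div_nonneg hx.1 hc.le, div_le_one_of_le₀ hx.2 hc.le⟩
  have hy : ∀ k : ℕ, (bernsteinPolynomial ℝ n k).eval (x / c) = bernstein n k y := fun _ ↦ rfl
  have hcy : c * (y : ℝ) = x := by
    change c * (x / c) = x
    field_simp
  have happ : |bernsteinApproximation n G y - G y| < ε := by
    have := (ContinuousMap.dist_apply_le_dist (f := bernsteinApproximation n G) (g := G) y).trans_lt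
      (hN n (by omega))
    rwa [Real.dist_eq] at this
  refine ⟨fun k ↦ bernstein_nonneg (n := n) (ν := k) (x := y), ?_, ?_, ?_⟩
  · simp only [hy]
    exact bernstein.probability n y
  · have h := congrArg (Polynomial.eval (x / c)) (bernsteinPolynomial.sum_smul ℝ n)
    simp only [Polynomial.eval_finsetSum, Finset.sum_range, nsmul_eq_mul, Polynomial.eval_mul,
      Polynomial.eval_natCast, Polynomial.eval_X] at h
    have hn0 : (n : ℝ) ≠ 0 := by positivity
    have h' : ∀ k : Fin (n + 1), c * (bernstein.z k : ℝ) * (bernsteinPolynomial ℝ n k).eval (x / c)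
        = c / n * ((k : ℕ) * (bernsteinPolynomial ℝ n k).eval (x / c)) := fun k ↦ by
      change c * ((k : ℕ) / (n : ℝ)) * _ = _
      ring
    simp only [h']
    rw [← Finset.mul_sum, h]
    field_simp
  · have h1 : bernsteinApproximation n G y =
        ∑ k : Fin (n + 1), g (c * (bernstein.z k : ℝ)) *
          (bernsteinPolynomial ℝ n k).eval (x / c) := by
      rw [bernsteinApproximation.apply]
      refine Finset.sum_congr rfl fun k _ ↦ ?_
      rw [hy, smul_eq_mul, mul_comm]
      rfl
    have h2 : G y = g x := congrArg g hcy
    rw [h1, h2] at happ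
    linarith [(abs_lt.mp happ).2]

/-- The Choi–Davis–Jensen inequality for subunital positive linear maps. -/
lemma OperatorConvexOn.cfc_map_le {f : ℝ → ℝ} (hfc : ContinuousOn f (Set.Ici 0))
    (hf : OperatorConvexOn f) (hf0 : f 0 ≤ 0) (Ψ : (H →L[ℂ] H) →ₗ[ℂ] (H →L[ℂ] H))
    (hΨ : ∀ A : H →L[ℂ] H, 0 ≤ A → 0 ≤ Ψ A) (hΨ1 : Ψ 1 ≤ 1)
    {T : H →L[ℂ] H} (hT : 0 ≤ T) : cfc f (Ψ T) ≤ Ψ (cfc f T) := by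
  have hTs : IsSelfAdjoint T := .of_nonneg hT
  have hmono : ∀ A B : H →L[ℂ] H, A ≤ B → Ψ A ≤ Ψ B := fun A B h ↦ by
    rw [← sub_nonneg, ← map_sub]
    exact hΨ _ (sub_nonneg.mpr h)
  have hΨr : ∀ (r : ℝ) (A : H →L[ℂ] H), Ψ (r • A) = r • Ψ A := fun r A ↦
    LinearMap.map_smul_of_tower Ψ r A
  have key : ∀ ε : ℝ, 0 < ε → cfc f (Ψ T) ≤ Ψ (cfc f T) + ε • (1 : H →L[ℂ] H) := by
    intro ε hε
    obtain ⟨m, φ, t, hφ, ht, hφt⟩ := exists_partition_approx (c := ‖T‖ + 1) (by positivity)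
      (hfc.mono fun x hx ↦ hx.1) hε
    have hsp : ∀ x ∈ spectrum ℝ T, x ∈ Set.Icc 0 (‖T‖ + 1) := by
      intro x hx
      refine ⟨spectrum_nonneg_of_nonneg hT hx, ?_⟩
      rcases subsingleton_or_nontrivial H with hH | hH
      · have : Subsingleton (H →L[ℂ] H) := inferInstance
        simp [spectrum.of_subsingleton] at hx
      · exact ((le_abs_self x).trans (spectrum.norm_le_norm_of_mem hx)).trans (by simp)
    have hcomb : ∀ s : Fin m → ℝ, cfc (fun x ↦ ∑ i, s i * φ i x) T = ∑ i, s i • cfc (φ i) T := by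
      intro s
      have h := cfc_sum_univ (fun i x ↦ s i * φ i x) T (fun i ↦ by fun_prop)
      rw [Finset.sum_fn] at h
      rw [h]
      exact Finset.sum_congr rfl fun i _ ↦ cfc_const_mul _ _ _ (by fun_prop)
    have h1 : ∑ i, cfc (φ i) T = 1 := by
      have := hcomb 1
      simp only [Pi.one_apply, one_mul, one_smul] at this
      rw [← this, cfc_congr (g := fun _ ↦ 1) fun x hx ↦ (hφt x (hsp x hx)).2.1, cfc_const_one ℝ T]
    have ht' : ∑ i, t i • cfc (φ i) T = T := by
      rw [← hcomb, cfc_congr (g := id) fun x hx ↦ (hφt x (hsp x hx)).2.2.1, cfc_id ℝ T]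
    have hfT : ∑ i, f (t i) • cfc (φ i) T ≤ cfc f T + ε • 1 := by
      have hfs := continuousOn_spectrum_of_nonneg hfc hT
      rw [← hcomb, ← Algebra.algebraMap_eq_smul_one, ← cfc_add_const ε f T hfs]
      exact cfc_mono (fun x hx ↦ (hφt x (hsp x hx)).2.2.2) (by fun_prop) (by fun_prop)
    let A : Option (Fin m) → H →L[ℂ] H := fun o ↦ o.elim (1 - Ψ 1) fun i ↦ Ψ (cfc (φ i) T)
    have hA : ∀ o, 0 ≤ A o := by
      rintro (_ | i)
      · exact sub_nonneg.mpr hΨ1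
      · exact hΨ _ (cfc_nonneg fun x hx ↦ (hφt x (hsp x hx)).1 i)
    have hA1 : ∑ o, A o = 1 := by
      simp [A, Fintype.sum_option, ← map_sum, h1]
    have hJ := hf.cfc_sum_smul_le hfc A hA hA1 (fun o ↦ o.elim 0 t) (by
      rintro (_ | i)
      · exact le_rfl
      · exact ht i)
    simp only [Fintype.sum_option, A, Option.elim, zero_smul, zero_add, ← hΨr, ← map_sum,
      ht'] at hJ
    calc _ ≤ _ := hJ
      _ ≤ 0 + Ψ (cfc f T + ε • 1) := by
        gcongr
        · exact smul_nonpos_of_nonpos_of_nonneg hf0 (sub_nonneg.mpr hΨ1)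
        · exact hmono _ _ hfT
      _ ≤ _ := by
        rw [zero_add, map_add, hΨr]
        gcongr
  have hlim : Filter.Tendsto (fun ε : ℝ ↦ Ψ (cfc f T) + ε • (1 : H →L[ℂ] H))
      (nhdsWithin 0 (Set.Ioi 0)) (nhds (Ψ (cfc f T))) := by
    have : Continuous fun ε : ℝ ↦ Ψ (cfc f T) + ε • (1 : H →L[ℂ] H) := by fun_prop
    simpa using (this.tendsto 0).mono_left nhdsWithin_le_nhds
  exact ge_of_tendsto hlim (by filter_upwards [self_mem_nhdsWithin] with ε hε using key ε hε)

lemma opSqrt_isSelfAdjoint (C : H →L[ℂ] H) : IsSelfAdjoint (opSqrt C) := cfc_predicate _ _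

lemma opInvSqrt_isSelfAdjoint (C : H →L[ℂ] H) : IsSelfAdjoint (opInvSqrt C) := cfc_predicate _ _

lemma opSqrt_mul_opInvSqrt {C : H →L[ℂ] H} (hC : ∀ x ∈ spectrum ℝ C, 0 < x)
    (hCs : IsSelfAdjoint C) : opSqrt C * opInvSqrt C = 1 := by
  rw [opSqrt, opInvSqrt, ← cfc_mul _ _ C (by fun_prop)
      (Real.continuous_sqrt.continuousOn.fun_inv₀ fun x hx ↦ (Real.sqrt_pos.mpr (hC x hx)).ne'),
    cfc_congr (g := fun _ ↦ 1) fun x hx ↦ mul_inv_cancel₀ (Real.sqrt_pos.mpr (hC x hx)).ne',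
    cfc_const_one ℝ C]

lemma opInvSqrt_mul_opSqrt {C : H →L[ℂ] H} (hC : ∀ x ∈ spectrum ℝ C, 0 < x)
    (hCs : IsSelfAdjoint C) : opInvSqrt C * opSqrt C = 1 := by
  have := congrArg star (opSqrt_mul_opInvSqrt hC hCs)
  simpa [(opSqrt_isSelfAdjoint C).star_eq, (opInvSqrt_isSelfAdjoint C).star_eq] using this

lemma opSqrt_mul_self {C : H →L[ℂ] H} (hC : ∀ x ∈ spectrum ℝ C, 0 < x)
    (hCs : IsSelfAdjoint C) : opSqrt C * opSqrt C = C := by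
  rw [opSqrt, ← cfc_mul _ _ C (by fun_prop) (by fun_prop),
    cfc_congr (g := fun x ↦ x) fun x hx ↦ Real.mul_self_sqrt (hC x hx).le, cfc_id' ℝ C]

lemma cfc_spectrum_pos {h : ℝ → ℝ} (hh : ContinuousOn h (Set.Ici 0))
    (hhpos : ∀ t : ℝ, 0 ≤ t → 0 < h t) {B : H →L[ℂ] H} (hB : 0 ≤ B) :
    ∀ x ∈ spectrum ℝ (cfc h B), 0 < x := by
  rw [cfc_map_spectrum h B (.of_nonneg hB) (continuousOn_spectrum_of_nonneg hh hB)]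
  rintro _ ⟨y, hy, rfl⟩
  exact hhpos y (spectrum_nonneg_of_nonneg hB hy)

lemma OperatorConcaveOn.neg {h : ℝ → ℝ} (hh : OperatorConcaveOn h) :
    OperatorConvexOn fun t ↦ -h t := by
  intro K _ _ _ A B hA hB hsA hsB lam hlam
  simp only [cfc_neg, smul_neg]
  rw [← neg_add]
  exact neg_le_neg (hh K A B hA hB hsA hsB lam hlam)

lemma fDelta_map_le {f h : ℝ → ℝ}
    (hf_cont : ContinuousOn f (Set.Ici (0 : ℝ))) (hh_cont : ContinuousOn h (Set.Ici (0 : ℝ)))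
    (hf : OperatorConvexOn f) (hf0 : f 0 ≤ 0)
    (hh : OperatorConcaveOn h) (hhpos : ∀ t : ℝ, 0 ≤ t → 0 < h t)
    (Φ : (H →L[ℂ] H) →ₗ[ℂ] (H →L[ℂ] H))
    (hΦpos : ∀ A : H →L[ℂ] H, 0 ≤ A → 0 ≤ Φ A) (hΦ1 : Φ 1 = 1)
    {A B : H →L[ℂ] H} (hA : 0 ≤ A) (hB : 0 ≤ B) :
    fDelta f h (Φ A) (Φ B) ≤ Φ (fDelta f h A B) := by
  have hCD : Φ (cfc h B) ≤ cfc h (Φ B) := by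
    have := hh.neg.cfc_map_le hh_cont.fun_neg (neg_nonpos.mpr (hhpos 0 le_rfl).le) Φ hΦpos hΦ1.le hB
    rwa [cfc_neg, cfc_neg, map_neg, neg_le_neg_iff] at this
  unfold fDelta
  have hC := cfc_spectrum_pos hh_cont hhpos hB
  have hD := cfc_spectrum_pos hh_cont hhpos (hΦpos B hB)
  have hCs : IsSelfAdjoint (cfc h B) := cfc_predicate _ _
  have hDs : IsSelfAdjoint (cfc h (Φ B)) := cfc_predicate _ _
  set C := cfc h B
  set D := cfc h (Φ B)
  have hC1 := opSqrt_mul_opInvSqrt hC hCs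
  have hC2 := opInvSqrt_mul_opSqrt hC hCs
  have hC3 := opSqrt_mul_self hC hCs
  have hD1 := opSqrt_mul_opInvSqrt hD hDs
  have hD2 := opInvSqrt_mul_opSqrt hD hDs
  have hD3 := opSqrt_mul_self hD hDs
  have hcs := opSqrt_isSelfAdjoint C
  have hci := opInvSqrt_isSelfAdjoint C
  have hds := opSqrt_isSelfAdjoint D
  have hdi := opInvSqrt_isSelfAdjoint D
  generalize opSqrt C = c at *
  generalize opInvSqrt C = c' at *
  generalize opSqrt D = d at *
  generalize opInvSqrt D = d' at *
  let Ψ : (H →L[ℂ] H) →ₗ[ℂ] (H →L[ℂ] H) :=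
    LinearMap.mulLeftRight ℂ (d', d') ∘ₗ Φ ∘ₗ LinearMap.mulLeftRight ℂ (c, c)
  have hΨa : ∀ X, Ψ X = d' * Φ (c * X * c) * d' := fun X ↦ by simp [Ψ, LinearMap.mulLeftRight_apply]
  have hΨpos : ∀ X : H →L[ℂ] H, 0 ≤ X → 0 ≤ Ψ X := fun X hX ↦ by
    rw [hΨa]
    exact hdi.conjugate_nonneg (hΦpos _ (hcs.conjugate_nonneg hX))
  have hΨ1 : Ψ 1 ≤ 1 := by
    rw [hΨa, mul_one, hC3]
    calc d' * Φ C * d' ≤ d' * D * d' := hdi.conjugate_le_conjugate hCD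
      _ = (d' * d) * (d * d') := by rw [← hD3]; noncomm_ring
      _ = 1 := by rw [hD1, hD2, one_mul]
  have hJ := hds.conjugate_le_conjugate
    (hf.cfc_map_le hf_cont hf0 Ψ hΨpos hΨ1 (hci.conjugate_nonneg hA))
  have hΨT : Ψ (c' * A * c') = d' * Φ A * d' := by
    have : c * (c' * A * c') * c = (c * c') * A * (c' * c) := by noncomm_ring
    rw [hΨa, this, hC1, hC2, one_mul, mul_one]
  rw [hΨT, hΨa] at hJ
  refine hJ.trans_eq ?_
  rw [← mul_assoc, ← mul_assoc, hD1, one_mul, mul_assoc, hD2, mul_one]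

/-- The generalized perspective functional `(f∇h)(L̃, R̃, p, q)` satisfies a
Choi–Davis–Jensen type inequality for unital positive linear maps:
`(f∇h)(Φ(L̃), Φ(R̃), p, q) ≤ Φ((f∇h)(L̃, R̃, p, q))`. -/
theorem stmt_12 (f h : ℝ → ℝ)
    (hf_cont : ContinuousOn f (Set.Ici (0 : ℝ))) (hh_cont : ContinuousOn h (Set.Ici (0 : ℝ)))
    (hf : OperatorConvexOn f) (hf0 : f 0 ≤ 0)
    (hh : OperatorConcaveOn h) (hhpos : ∀ t : ℝ, 0 ≤ t → 0 < h t)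
    (n : ℕ) (p q : Fin n → ℝ) (hp : ∀ i, 0 ≤ p i) (hq : ∀ i, 0 ≤ q i)
    (hp1 : ∑ i, p i = 1) (hq1 : ∑ i, q i = 1)
    (Φ : (H →L[ℂ] H) →ₗ[ℂ] (H →L[ℂ] H))
    (hΦpos : ∀ A : H →L[ℂ] H, 0 ≤ A → 0 ≤ Φ A) (hΦ1 : Φ 1 = 1)
    (L R : Fin n → H →L[ℂ] H)
    (hL : ∀ i, 0 ≤ L i) (hR : ∀ i, 0 ≤ R i ∧ IsUnit (R i)) :
    (∑ i, p i • fDelta f h (Φ (L i)) (q i • Φ (R i))) ≤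
      Φ (∑ i, p i • fDelta f h (L i) (q i • R i)) := by
  have hrw : ∀ i, p i • fDelta f h (Φ (L i)) (q i • Φ (R i)) ≤
      p i • Φ (fDelta f h (L i) (q i • R i)) := fun i ↦ by
    rw [← LinearMap.map_smul_of_tower Φ (q i)]
    exact smul_le_smul_of_nonneg_left
      (fDelta_map_le hf_cont hh_cont hf hf0 hh hhpos Φ hΦpos hΦ1 (hL i)
        (smul_nonneg (hq i) (hR i).1)) (hp i)
  rw [map_sum]
  refine Finset.sum_le_sum fun i _ ↦ (hrw i).trans_eq ?_
  rw [LinearMap.map_smul_of_tower]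
end
end

section
/- Let f : [0,∞) → ℝ be operator convex and differentiable, let L_1,…,L_n be positive operators on H and R_1,…,R_n strictly positive operators on H. Then f(1)·∑_{i=1}^n R_i − f'(1)·∑_{i=1}^n (R_i − L_i) ≤ ∑_{i=1}^n g(L_i,R_i) in the Loewner order, where f(1), f'(1) are real scalars. -/
open scoped InnerProductSpace

noncomputable section

variable {H : Type} [NormedAddCommGroup H] [InnerProductSpace ℂ H] [CompleteSpace H]

/-- An operator convex function is convex as a real function. -/
lemma OperatorConvexOn.convexOn {f : ℝ → ℝ} (hf : OperatorConvexOn f) :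
    ConvexOn ℝ (Set.Ici (0 : ℝ)) f := by
  refine ⟨convex_Ici 0, fun x hx y hy a b ha hb hab => ?_⟩
  have hsa (r : ℝ) : IsSelfAdjoint (algebraMap ℝ (ℂ →L[ℂ] ℂ) r) := .algebraMap _ (.all r)
  have hspec (r : ℝ) (hr : r ∈ Set.Ici (0 : ℝ)) :
      spectrum ℝ (algebraMap ℝ (ℂ →L[ℂ] ℂ) r) ⊆ Set.Ici (0 : ℝ) := by
    rw [spectrum.scalar_eq]
    simpa using hr
  have h := hf ℂ _ _ (hsa x) (hsa y) (hspec x hx) (hspec y hy) a ⟨ha, by linarith⟩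
  obtain rfl : b = 1 - a := by linarith
  have hcomb (u v : ℝ) :
      a • algebraMap ℝ (ℂ →L[ℂ] ℂ) u + (1 - a) • algebraMap ℝ (ℂ →L[ℂ] ℂ) v =
        algebraMap ℝ (ℂ →L[ℂ] ℂ) (a * u + (1 - a) * v) := by
    simp only [Algebra.algebraMap_eq_smul_one]
    module
  rw [hcomb, cfc_algebraMap, cfc_algebraMap, cfc_algebraMap, hcomb] at h
  simpa using (algebraMap_le_algebraMap (α := ℝ) (β := ℂ →L[ℂ] ℂ)).1 h

/-- A convex function on `[0, ∞)` lies above its tangent line at `1`. -/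
lemma ConvexOn.tangent_at_one_le {f : ℝ → ℝ} (hf : ConvexOn ℝ (Set.Ici (0 : ℝ)) f)
    (hd : DifferentiableWithinAt ℝ f (Set.Ici (0 : ℝ)) 1) {t : ℝ} (ht : 0 ≤ t) :
    f 1 + derivWithin f (Set.Ici (0 : ℝ)) 1 * (t - 1) ≤ f t := by
  have h1 : (1 : ℝ) ∈ Set.Ici (0 : ℝ) := Set.mem_Ici.2 zero_le_one
  rcases lt_trichotomy t 1 with h | rfl | h
  · have := hf.slope_le_derivWithin (x := t) (y := 1) ht h1 h hd
    rw [slope_def_field, div_le_iff₀ (by linarith)] at this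
    linarith
  · simp
  · have := hf.derivWithin_le_slope (x := 1) (y := t) h1 ht h hd
    rw [slope_def_field, le_div_iff₀ (by linarith)] at this
    linarith

lemma opSqrt_mul_self_s13 {R : H →L[ℂ] H} (hR : 0 ≤ R) : opSqrt R * opSqrt R = R := by
  rw [opSqrt, ← cfc_mul Real.sqrt Real.sqrt R]
  conv_rhs => rw [← cfc_id ℝ R]
  exact cfc_congr fun t ht => Real.mul_self_sqrt (spectrum_nonneg_of_nonneg hR ht)

lemma continuousOn_inv_sqrt_spectrum {R : H →L[ℂ] H} (hR : 0 ≤ R) (hu : IsUnit R) :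
    ContinuousOn (fun t : ℝ => (Real.sqrt t)⁻¹) (spectrum ℝ R) := by
  refine Real.continuous_sqrt.continuousOn.inv₀ fun t ht => ?_
  have h0 : t ≠ 0 := fun h => spectrum.zero_notMem ℝ hu (h ▸ ht)
  exact (Real.sqrt_pos.2 (lt_of_le_of_ne (spectrum_nonneg_of_nonneg hR ht) h0.symm)).ne'

lemma opSqrt_mul_opInvSqrt_s13 {R : H →L[ℂ] H} (hR : 0 ≤ R) (hu : IsUnit R) :
    opSqrt R * opInvSqrt R = 1 := by
  rw [opSqrt, opInvSqrt, ← cfc_mul Real.sqrt _ R Real.continuous_sqrt.continuousOn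
    (continuousOn_inv_sqrt_spectrum hR hu), ← cfc_one ℝ R]
  refine cfc_congr fun t ht => ?_
  have h0 : t ≠ 0 := fun h => spectrum.zero_notMem ℝ hu (h ▸ ht)
  exact mul_inv_cancel₀
    (Real.sqrt_pos.2 (lt_of_le_of_ne (spectrum_nonneg_of_nonneg hR ht) h0.symm)).ne'

lemma opInvSqrt_mul_opSqrt_s13 {R : H →L[ℂ] H} (hR : 0 ≤ R) (hu : IsUnit R) :
    opInvSqrt R * opSqrt R = 1 := by
  rw [← opSqrt_mul_opInvSqrt_s13 hR hu]
  exact cfc_commute_cfc _ _ R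

/-- The perspective inherits an affine lower bound `c + d t ≤ f t` valid on `[0, ∞)`. -/
lemma affine_le_persp {f : ℝ → ℝ} (hf : ContinuousOn f (Set.Ici (0 : ℝ))) {c d : ℝ}
    (hcd : ∀ t, 0 ≤ t → c + d * t ≤ f t) {L R : H →L[ℂ] H} (hL : 0 ≤ L) (hR : 0 ≤ R)
    (hu : IsUnit R) : c • R + d • L ≤ persp f L R := by
  have hS : IsSelfAdjoint (opSqrt R) := cfc_predicate _ R
  have hI : IsSelfAdjoint (opInvSqrt R) := cfc_predicate _ R
  set X := opInvSqrt R * L * opInvSqrt R with hXdef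
  have hX : 0 ≤ X := hI.conjugate_nonneg hL
  have hXsa : IsSelfAdjoint X := .of_nonneg hX
  have hle : c • (1 : H →L[ℂ] H) + d • X ≤ cfc f X := by
    have h : cfc (fun t : ℝ => c + d * t) X = c • (1 : H →L[ℂ] H) + d • X := by
      rw [cfc_const_add c (fun t : ℝ => d * t) X, cfc_const_mul_id d X,
        Algebra.algebraMap_eq_smul_one]
    rw [← h]
    exact cfc_mono (fun t ht => hcd t (spectrum_nonneg_of_nonneg hX ht)) (by fun_prop)
      (hf.mono fun t ht => spectrum_nonneg_of_nonneg hX ht)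
  have hconj : opSqrt R * X * opSqrt R = L := by
    calc opSqrt R * X * opSqrt R
        = (opSqrt R * opInvSqrt R) * L * (opInvSqrt R * opSqrt R) := by
          simp only [hXdef, mul_assoc]
      _ = L := by rw [opSqrt_mul_opInvSqrt_s13 hR hu, opInvSqrt_mul_opSqrt_s13 hR hu, one_mul, mul_one]
  have h := hS.conjugate_le_conjugate hle
  rwa [mul_add, add_mul, mul_smul_comm, smul_mul_assoc, mul_one, opSqrt_mul_self_s13 hR,
    mul_smul_comm, smul_mul_assoc, hconj] at h

/-- For a differentiable operator convex `f`:
`f(1) • ∑ R i − f'(1) • ∑ (R i − L i) ≤ ∑ g(L i, R i)`. -/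
theorem stmt_13 (f : ℝ → ℝ) (hf_cont : ContinuousOn f (Set.Ici (0 : ℝ)))
    (hf : OperatorConvexOn f) (hdiff : DifferentiableOn ℝ f (Set.Ici (0 : ℝ)))
    (n : ℕ) (L R : Fin n → H →L[ℂ] H)
    (hL : ∀ i, 0 ≤ L i) (hR : ∀ i, 0 ≤ R i ∧ IsUnit (R i)) :
    f 1 • (∑ i, R i) - derivWithin f (Set.Ici (0 : ℝ)) 1 • (∑ i, (R i - L i)) ≤
      ∑ i, persp f (L i) (R i) := by
  set d := derivWithin f (Set.Ici (0 : ℝ)) 1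
  have htan (t : ℝ) (ht : 0 ≤ t) : (f 1 - d) + d * t ≤ f t := by
    have := hf.convexOn.tangent_at_one_le (hdiff 1 (Set.mem_Ici.2 zero_le_one)) ht
    linarith
  rw [Finset.smul_sum, Finset.smul_sum, ← Finset.sum_sub_distrib]
  refine Finset.sum_le_sum fun i _ => ?_
  convert affine_le_persp hf_cont htan (hL i) (hR i).1 (hR i).2 using 1
  module
end
end
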